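/- arXiv:1806.10304 — 4 statements merged into one kernel-verified Lean document; each statement's English description precedes it below -/
import Mathlib

section
/- Let m ≥ 1 and let s, k, n be any integers. Let (L_n(x))_{n∈ℤ} be the sequence of Lucas polynomials and (F_n(x))_{n∈ℤ} the sequence of Fibonacci polynomials. Then det( [ L_{s+k(n+i+j)}(x)^m ]_{0≤i,j≤m} ) = (−1)^{(s+kn)·C(m+1,2)} · (x²+4)^{C(m+1,2)} · ∏_{i=0}^{m} C(m,i) · F_{(i+1)k}(x)^{2(m−i)}, where C(·,·) are binomial coefficients; this is an identity of real polynomials. -/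
open Polynomial Finset

/-- A two-sided sequence satisfying `u (n + 2) = x * u (n + 1) + u n` is determined by `u 0`
and `u 1`. -/
theorem eq_of_two_sided_recurrence {R : Type*} [CommRing R] (x : R) (u v : ℤ → R)
    (hu : ∀ n, u (n + 2) = x * u (n + 1) + u n) (hv : ∀ n, v (n + 2) = x * v (n + 1) + v n)
    (h0 : u 0 = v 0) (h1 : u 1 = v 1) (n : ℤ) : u n = v n := by
  suffices h : u n = v n ∧ u (n + 1) = v (n + 1) from h.1
  induction n using Int.induction_on with
  | zero => exact ⟨h0, by simpa using h1⟩
  | succ i ih =>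
    refine ⟨ih.2, ?_⟩
    rw [add_assoc, one_add_one_eq_two, hu, hv, ih.1, ih.2]
  | pred i ih =>
    have hu' := hu (-(i : ℤ) - 1)
    have hv' := hv (-(i : ℤ) - 1)
    rw [show -(i : ℤ) - 1 + 2 = -i + 1 by ring, sub_add_cancel] at hu' hv'
    rw [sub_add_cancel]
    exact ⟨by linear_combination hv' - hu' + ih.2 - x * ih.1, ih.1⟩

theorem prod_pow_mul_pow_sub {M : Type*} [CommMonoid M] (a b : M) (N : ℕ) :
    ∏ i ∈ range (N + 1), a ^ i * b ^ (N - i) = (a * b) ^ (N + 1).choose 2 := by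
  have h : ∏ i ∈ range (N + 1), b ^ (N - i) = ∏ i ∈ range (N + 1), b ^ i := by
    simpa using prod_range_reflect (fun i => b ^ i) (N + 1)
  rw [prod_mul_distrib, h, prod_pow_eq_pow_sum, prod_pow_eq_pow_sum, sum_range_id,
    ← Nat.choose_two_right, mul_pow]

theorem prod_range_pow_sub {M : Type*} [CommMonoid M] (c : M) (m : ℕ) :
    ∏ d ∈ range m, c ^ (m - d) = c ^ (m + 1).choose 2 := by
  have h := prod_pow_mul_pow_sub 1 c m
  simpa [prod_range_succ] using h

/-- A product over pairs `i < j` can be arranged by the difference of the indices. -/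
theorem prod_prod_Ioi_eq_prod_diff {M : Type*} [CommMonoid M] (m : ℕ) (f : ℕ → ℕ → M) :
    ∏ i : Fin (m + 1), ∏ j ∈ Ioi i, f i j
      = ∏ d ∈ range m, ∏ i ∈ range (m - d), f i (i + d + 1) := by
  induction m generalizing f with
  | zero => simp
  | succ m ih =>
    rw [Fin.prod_univ_succ]
    simp only [Fin.prod_Ioi_zero, Fin.prod_Ioi_succ, Fin.val_succ, Fin.val_zero]
    rw [ih fun i j => f (i + 1) (j + 1), Fin.prod_univ_eq_prod_range (fun j => f 0 (j + 1)),
      prod_range_succ, prod_range_succ _ m, mul_right_comm, ← prod_mul_distrib]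
    congr 1
    · refine prod_congr rfl fun d hd => ?_
      rw [Nat.sub_add_comm (mem_range.1 hd).le, prod_range_succ', mul_comm]
      simp only [zero_add, add_right_comm]
    · simp

/-- The determinant of `∑ r, c r * q r ^ i * q r ^ j`. -/
theorem det_sum_mul_pow_mul_pow {R : Type*} [CommRing R] (m : ℕ) (c q : ℕ → R) :
    Matrix.det (Matrix.of fun i j : Fin (m + 1) =>
        ∑ r ∈ range (m + 1), c r * (q r ^ (i : ℕ) * q r ^ (j : ℕ)))
      = (∏ r ∈ range (m + 1), c r)
        * ∏ d ∈ range m, ∏ i ∈ range (m - d), (q (i + d + 1) - q i) ^ 2 := by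
  have hM : (Matrix.of fun i j : Fin (m + 1) =>
        ∑ r ∈ range (m + 1), c r * (q r ^ (i : ℕ) * q r ^ (j : ℕ)))
      = (Matrix.vandermonde fun r : Fin (m + 1) => q r).transpose
        * Matrix.diagonal (fun r : Fin (m + 1) => c r)
        * Matrix.vandermonde fun r : Fin (m + 1) => q r := by
    ext i j
    rw [Matrix.mul_apply, Matrix.of_apply, ← Fin.sum_univ_eq_sum_range
      (fun r => c r * (q r ^ (i : ℕ) * q r ^ (j : ℕ)))]
    refine sum_congr rfl fun r _ => ?_
    rw [Matrix.mul_diagonal, Matrix.transpose_apply, Matrix.vandermonde_apply,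
      Matrix.vandermonde_apply]
    ring
  rw [hM, Matrix.det_mul, Matrix.det_mul, Matrix.det_transpose, Matrix.det_diagonal,
    Matrix.det_vandermonde, ← prod_prod_Ioi_eq_prod_diff m fun i j => (q j - q i) ^ 2,
    Fin.prod_univ_eq_prod_range c]
  simp only [prod_pow]
  ring

/-- Evaluation of the power determinant of `α ^ n + β ^ n` when `α * β = -1`. -/
theorem det_zpow_add_zpow_pow {K : Type*} [Field K] (α β : K) (hαβ : α * β = -1) (f : ℤ → K)
    (hf : ∀ n, α ^ n - β ^ n = (α - β) * f n) (m : ℕ) (t k : ℤ) :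
    Matrix.det (Matrix.of fun i j : Fin (m + 1) =>
        (α ^ (t + k * (i.1 + j.1)) + β ^ (t + k * (i.1 + j.1))) ^ m)
      = (-1) ^ (t * ((m + 1).choose 2 : ℤ)) * ((α - β) ^ 2) ^ (m + 1).choose 2
        * ∏ i ∈ range (m + 1), ((m.choose i : K) * f ((i + 1) * k) ^ (2 * (m - i))) := by
  have hα : α ≠ 0 := by rintro rfl; simp at hαβ
  have hβ : β ≠ 0 := by rintro rfl; simp at hαβ
  have hsplit : ∀ (γ : K), γ ≠ 0 → ∀ i j : ℕ,
      γ ^ (t + k * (i + j)) = γ ^ t * ((γ ^ k) ^ i * (γ ^ k) ^ j) := by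
    intro γ hγ i j
    rw [zpow_add₀ hγ, zpow_mul, ← pow_add, ← zpow_natCast (γ ^ k)]
    push_cast
    rfl
  have hM : (Matrix.of fun i j : Fin (m + 1) =>
        (α ^ (t + k * (i.1 + j.1)) + β ^ (t + k * (i.1 + j.1))) ^ m)
      = Matrix.of fun i j : Fin (m + 1) => ∑ r ∈ range (m + 1),
        ((m.choose r : K) * ((α ^ t) ^ r * (β ^ t) ^ (m - r)))
          * (((α ^ k) ^ r * (β ^ k) ^ (m - r)) ^ (i : ℕ)
            * ((α ^ k) ^ r * (β ^ k) ^ (m - r)) ^ (j : ℕ)) := by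
    ext i j
    rw [Matrix.of_apply, Matrix.of_apply, add_pow, hsplit α hα, hsplit β hβ]
    refine sum_congr rfl fun r _ => ?_
    ring
  have hsq : (α ^ k * β ^ k) ^ 2 = 1 := by
    rw [← mul_zpow, hαβ, ← zpow_natCast, ← zpow_mul, mul_comm, zpow_mul]
    simp
  have hdiff : ∀ d ∈ range m, ∏ i ∈ range (m - d),
      ((α ^ k) ^ (i + d + 1) * (β ^ k) ^ (m - (i + d + 1)) - (α ^ k) ^ i * (β ^ k) ^ (m - i)) ^ 2
        = ((α - β) ^ 2) ^ (m - d) * f ((d + 1) * k) ^ (2 * (m - d)) := by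
    intro d hd
    obtain ⟨N, rfl⟩ : ∃ N, m = N + d + 1 :=
      ⟨m - d - 1, by have := mem_range.1 hd; omega⟩
    have hfd : (α ^ k) ^ (d + 1) - (β ^ k) ^ (d + 1) = (α - β) * f ((d + 1) * k) := by
      rw [← hf, mul_comm _ k, zpow_mul, zpow_mul]
      norm_cast
    have hterm : ∀ i ∈ range (N + 1),
        ((α ^ k) ^ (i + d + 1) * (β ^ k) ^ (N + d + 1 - (i + d + 1))
            - (α ^ k) ^ i * (β ^ k) ^ (N + d + 1 - i)) ^ 2
          = ((α ^ k) ^ i * (β ^ k) ^ (N - i)) ^ 2 * ((α - β) * f ((d + 1) * k)) ^ 2 := by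
      intro i hi
      have hi' := mem_range.1 hi
      rw [show N + d + 1 - (i + d + 1) = N - i by omega,
        show N + d + 1 - i = N - i + (d + 1) by omega, ← hfd]
      ring
    rw [show N + d + 1 - d = N + 1 by omega, prod_congr rfl hterm, prod_mul_distrib, prod_pow,
      prod_pow_mul_pow_sub, ← pow_mul, mul_comm _ 2, pow_mul, hsq, one_pow, one_mul, prod_const,
      card_range, mul_pow, mul_pow, ← pow_mul (f _)]
  have hF : ∏ i ∈ range (m + 1), f ((i + 1) * k) ^ (2 * (m - i))
      = ∏ i ∈ range m, f ((i + 1) * k) ^ (2 * (m - i)) := by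
    simp [prod_range_succ]
  rw [hM, det_sum_mul_pow_mul_pow m _ fun r => (α ^ k) ^ r * (β ^ k) ^ (m - r),
    prod_congr rfl hdiff, prod_mul_distrib, prod_pow_mul_pow_sub, prod_mul_distrib,
    prod_mul_distrib, prod_range_pow_sub, hF, ← mul_zpow, hαβ, zpow_mul, zpow_natCast]
  ring

/-- **Corollary 3, first identity.** For the Lucas polynomials `(L_n(x))_{n∈ℤ}` and
Fibonacci polynomials `(F_n(x))_{n∈ℤ}`,
`det([L_{s+k(n+i+j)}(x)^m]) = (−1)^{(s+kn)·C(m+1,2)} (x²+4)^{C(m+1,2)}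
  · ∏_{i=0}^m C(m,i)·F_{(i+1)k}(x)^{2(m−i)}`. -/
theorem det_power_matrix_lucas_polynomials
    (m : ℕ) (hm : 1 ≤ m) (s k n : ℤ)
    (L F : ℤ → Polynomial ℝ)
    (hL0 : L 0 = 2) (hL1 : L 1 = X)
    (hLrec : ∀ n : ℤ, L (n + 2) = X * L (n + 1) + L n)
    (hF0 : F 0 = 0) (hF1 : F 1 = 1)
    (hFrec : ∀ n : ℤ, F (n + 2) = X * F (n + 1) + F n) :
    Matrix.det (Matrix.of fun i j : Fin (m + 1) =>
        (L (s + k * (n + i.1 + j.1))) ^ m)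
      = Polynomial.C ((-1 : ℝ) ^ ((s + k * n) * (Nat.choose (m + 1) 2 : ℤ)))
        * (X ^ 2 + Polynomial.C 4) ^ (Nat.choose (m + 1) 2)
        * ∏ i ∈ Finset.range (m + 1),
            ((Nat.choose m i : Polynomial ℝ) * (F (((i : ℤ) + 1) * k)) ^ (2 * (m - i))) := by
  refine Polynomial.funext fun x => ?_
  set w := √(x ^ 2 + 4)
  have hw : w ^ 2 = x ^ 2 + 4 := Real.sq_sqrt (by positivity)
  set α := (x + w) / 2 with hα_def
  set β := (x - w) / 2 with hβ_def
  have hαβ : α * β = -1 := by linear_combination -hw / 4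
  have hα : α ≠ 0 := by intro h; simp [h] at hαβ
  have hβ : β ≠ 0 := by intro h; simp [h] at hαβ
  have hw0 : w ≠ 0 := (Real.sqrt_pos.2 (by positivity)).ne'
  have hsub : α - β = w := by ring
  have hα_sq : α ^ 2 = x * α + 1 := by linear_combination hw / 4
  have hβ_sq : β ^ 2 = x * β + 1 := by linear_combination hw / 4
  have hα_rec : ∀ n : ℤ, α ^ (n + 2) = x * α ^ (n + 1) + α ^ n := fun n => by
    rw [zpow_add₀ hα, zpow_add₀ hα, zpow_one, zpow_ofNat]
    linear_combination α ^ n * hα_sq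
  have hβ_rec : ∀ n : ℤ, β ^ (n + 2) = x * β ^ (n + 1) + β ^ n := fun n => by
    rw [zpow_add₀ hβ, zpow_add₀ hβ, zpow_one, zpow_ofNat]
    linear_combination β ^ n * hβ_sq
  have hL : ∀ n, (L n).eval x = α ^ n + β ^ n := by
    refine eq_of_two_sided_recurrence x _ _ (fun n => by simp [hLrec]) (fun n => ?_) ?_ ?_
    · rw [hα_rec, hβ_rec]; ring
    · norm_num [hL0]
    · simp only [hL1, eval_X, zpow_one]; ring
  have hF : ∀ n, α ^ n - β ^ n = (α - β) * (F n).eval x := by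
    refine eq_of_two_sided_recurrence x _ _ (fun n => ?_) (fun n => ?_) ?_ ?_
    · rw [hα_rec, hβ_rec]; ring
    · simp only [hFrec, eval_add, eval_mul, eval_X]; ring
    · simp [hF0]
    · simp [hF1]
  have key := det_zpow_add_zpow_pow α β hαβ (fun n => (F n).eval x) hF m (s + k * n) k
  rw [hsub, hw] at key
  rw [← coe_evalRingHom, RingHom.map_det]
  simp only [coe_evalRingHom, eval_mul, eval_C, eval_pow, eval_add, eval_X, eval_prod,
    eval_natCast]
  rw [← key]
  congr 1
  ext i j
  simp only [RingHom.mapMatrix_apply, Matrix.map_apply, Matrix.of_apply, coe_evalRingHom, eval_pow,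
    hL]
  rw [show s + k * (n + i.1 + j.1) = s + k * n + k * (i.1 + j.1) by ring]
end

section
/- Let m ≥ 1, let s, k, n be any integers, and let (d_i)_{1≤i≤m}, (e_i)_{1≤i≤m} be sequences of integers. Let (L_n(x))_{n∈ℤ} be the sequence of Lucas polynomials and (F_n(x))_{n∈ℤ} the sequence of Fibonacci polynomials. Then det( [ ∏_{f=j+1}^{m} L_{s+k(n+i+d_f)}(x) · ∏_{g=1}^{j} L_{s+k(n+i+e_g)}(x) ]_{0≤i,j≤m} ) = (−1)^{(s+kn)·C(m+1,2) + k·C(m+1,3)} · (x²+4)^{C(m+1,2)} · ∏_{l=1}^{m} F_{kl}(x)^{m+1−l} · ∏_{1≤i≤j≤m} (−1)^{k·d_j} · F_{k(e_i−d_j)}(x), where C(·,·) are binomial coefficients; this is an identity of real polynomials. -/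
open Polynomial Finset

section HomogeneousDeterminant

variable {R : Type*} [CommRing R]

/-- A product of `N` linear forms in `u, v` is a combination of the monomials of degree `N`. -/
lemma exists_coeff_prod_linear_forms {ι : Type*} (S : Finset ι) (p q : ι → R) :
    ∃ c : ℕ → R, ∀ u v : R, ∏ i ∈ S, (u * p i + v * q i)
      = ∑ a ∈ range (#S + 1), v ^ a * u ^ (#S - a) * c a := by
  classical
  induction S using Finset.induction_on with
  | empty => exact ⟨fun _ => 1, by simp⟩
  | insert x S hx ih =>
    obtain ⟨c, hc⟩ := ih
    refine ⟨fun a => p x * (if a ≤ #S then c a else 0) + q x * (if a = 0 then 0 else c (a - 1)),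
      fun u v => ?_⟩
    rw [prod_insert hx, hc, card_insert_of_notMem hx, add_mul]
    simp only [mul_add, sum_add_distrib]
    congr 1
    · rw [sum_range_succ _ (#S + 1), mul_sum]
      simp only [Nat.not_succ_le_self, if_false, mul_zero, add_zero]
      refine sum_congr rfl fun a ha => ?_
      have ha' : a ≤ #S := Nat.lt_succ_iff.mp (mem_range.mp ha)
      rw [if_pos ha', Nat.sub_add_comm ha', pow_succ]
      ring
    · rw [sum_range_succ' _ (#S + 1), mul_sum]
      simp only [Nat.add_sub_add_right, Nat.add_eq_zero_iff, one_ne_zero, and_false, if_false,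
        if_true, mul_zero, add_zero, Nat.add_sub_cancel]
      refine sum_congr rfl fun a _ => ?_
      rw [pow_succ]
      ring

/-- The matrix whose `j`-th column is the product of the linear forms `p f, q f` with `j ≤ f < m`
and `r g, t g` with `g < j`, evaluated at the points `(u i, v i)`. -/
def linearFormMatrix (m : ℕ) (p q r t : ℕ → R) (u v : Fin (m + 1) → R) :
    Matrix (Fin (m + 1)) (Fin (m + 1)) R :=
  Matrix.of fun i j => (∏ f ∈ Ico j.1 m, (u i * p f + v i * q f))
    * ∏ g ∈ range j.1, (u i * r g + v i * t g)

lemma exists_det_linearFormMatrix (m : ℕ) (p q r t : ℕ → R) :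
    ∃ c : R, ∀ u v : Fin (m + 1) → R,
      (linearFormMatrix m p q r t u v).det = (Matrix.projVandermonde v u).det * c := by
  have h (j : Fin (m + 1)) : ∃ c : ℕ → R, ∀ u v : R,
      (∏ f ∈ Ico j.1 m, (u * p f + v * q f)) * ∏ g ∈ range j.1, (u * r g + v * t g)
        = ∑ a ∈ range (m + 1), v ^ a * u ^ (m - a) * c a := by
    obtain ⟨c, hc⟩ := exists_coeff_prod_linear_forms ((Ico j.1 m).disjSum (range j.1))
      (Sum.elim p r) (Sum.elim q t)
    have hcard : #((Ico j.1 m).disjSum (range j.1)) = m := by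
      rw [card_disjSum, Nat.card_Ico, card_range]; omega
    rw [hcard] at hc
    exact ⟨c, fun u v => by rw [← hc, prod_disjSum]; rfl⟩
  choose c hc using h
  refine ⟨(Matrix.of fun a j : Fin (m + 1) => c j a.1).det, fun u v => ?_⟩
  rw [← Matrix.det_mul]
  congr 1
  ext i j
  simp only [linearFormMatrix, Matrix.of_apply, Matrix.mul_apply, hc, Matrix.projVandermonde_apply,
    Fin.val_rev, Finset.sum_range, Nat.add_sub_add_right]

lemma det_linearFormMatrix_cons (m : ℕ) (p q r t : ℕ → R) (u v : Fin (m + 1) → R) :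
    (linearFormMatrix (m + 1) p q r t (Fin.cons (t 0) u) (Fin.cons (-r 0) v)).det
      = (∏ f ∈ range (m + 1), (p f * t 0 - q f * r 0)) * ((∏ i, (u i * r 0 + v i * t 0)) *
        (linearFormMatrix m (fun f => p (f + 1)) (fun f => q (f + 1)) (fun f => r (f + 1))
          (fun f => t (f + 1)) u v).det) := by
  rw [Matrix.det_succ_row_zero, Fin.sum_univ_succ, ← Matrix.det_mul_column]
  rw [Finset.sum_eq_zero, add_zero]
  · simp only [Fin.val_zero, pow_zero, one_mul]
    congr 1
    · simp only [linearFormMatrix, Matrix.of_apply, Fin.cons_zero, Fin.val_zero, range_zero,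
        prod_empty, mul_one, Nat.Ico_zero_eq_range]
      exact prod_congr rfl fun f _ => by ring
    · congr 1
      ext i j
      simp only [linearFormMatrix, Matrix.of_apply, Matrix.submatrix_apply, Fin.cons_succ,
        Fin.succAbove_zero, Fin.val_succ, prod_range_succ']
      rw [← prod_Ico_add' (fun f => u i * p f + v i * q f)]
      ring
  · intro j _
    have : linearFormMatrix (m + 1) p q r t (Fin.cons (t 0) u) (Fin.cons (-r 0) v) 0 j.succ
        = 0 := by
      simp only [linearFormMatrix, Matrix.of_apply, Fin.cons_zero, Fin.val_succ, prod_range_succ']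
      ring
    rw [this]
    ring

lemma det_projVandermonde_cons (m : ℕ) (a b : R) (u v : Fin m → R) :
    (Matrix.projVandermonde (Fin.cons (-b) v : Fin (m + 1) → R) (Fin.cons a u)).det
      = (∏ i, (u i * b + v i * a)) * (Matrix.projVandermonde v u).det := by
  simp only [Matrix.det_projVandermonde, Fin.prod_univ_succ, Fin.prod_Ioi_zero,
    Fin.prod_Ioi_succ, Fin.cons_zero, Fin.cons_succ]
  congr 1
  exact prod_congr rfl fun i _ => by ring

lemma exists_injective_linear_ne_zero [IsDomain R] [Infinite R] {a b : R} (h : a ≠ 0 ∨ b ≠ 0) :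
    ∃ w : ℕ → R, Function.Injective w ∧ ∀ i, a + w i * b ≠ 0 := by
  have hfin : {x : R | a + x * b = 0}.Finite := by
    refine Set.Subsingleton.finite fun x hx y hy => ?_
    have hb : b ≠ 0 := by
      rintro rfl
      simp_all
    have : (x - y) * b = 0 := by
      linear_combination (Set.mem_ofPred.mp hx) - (Set.mem_ofPred.mp hy)
    exact sub_eq_zero.mp ((mul_eq_zero.mp this).resolve_right hb)
  have := hfin.infinite_compl.to_subtype
  let w := Infinite.natEmbedding ({x : R | a + x * b = 0}ᶜ : Set R)
  exact ⟨fun i => (w i).1, Subtype.val_injective.comp w.injective, fun i => (w i).2⟩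

/-- A projective version of Krattenthaler's determinant evaluation. -/
theorem det_linearFormMatrix [IsDomain R] [Infinite R] (m : ℕ) (p q r t : ℕ → R)
    (u v : Fin (m + 1) → R) :
    (linearFormMatrix m p q r t u v).det = (Matrix.projVandermonde v u).det
      * ∏ f ∈ range m, ∏ g ∈ range (f + 1), (p f * t g - q f * r g) := by
  induction m generalizing p q r t with
  | zero => simp [linearFormMatrix, Matrix.projVandermonde_apply]
  | succ m ih =>
    have hprod : ∏ f ∈ range (m + 1), ∏ g ∈ range (f + 1), (p f * t g - q f * r g)
        = (∏ f ∈ range (m + 1), (p f * t 0 - q f * r 0)) * ∏ f ∈ range m, ∏ g ∈ range (f + 1),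
          (p (f + 1) * t (g + 1) - q (f + 1) * r (g + 1)) := by
      simp only [prod_range_succ' _ (_ : ℕ), prod_mul_distrib, range_zero, prod_empty, one_mul]
      ring
    by_cases h : r 0 ≠ 0 ∨ t 0 ≠ 0
    · obtain ⟨w, hw, hne⟩ := exists_injective_linear_ne_zero h
      obtain ⟨c, hc⟩ := exists_det_linearFormMatrix (m + 1) p q r t
      have key := hc (Fin.cons (t 0) fun _ => 1) (Fin.cons (-r 0) fun i => w i)
      rw [det_linearFormMatrix_cons, det_projVandermonde_cons, ih] at key
      have h1 : ∏ i : Fin (m + 1), (1 * r 0 + w i * t 0) ≠ 0 :=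
        prod_ne_zero_iff.mpr fun i _ => by simpa using hne i
      have h2 : (Matrix.projVandermonde (fun i : Fin (m + 1) => w i) fun _ => 1).det ≠ 0 := by
        rw [Matrix.det_projVandermonde]
        refine prod_ne_zero_iff.mpr fun i _ => prod_ne_zero_iff.mpr fun j hj => ?_
        simp only [mul_one, sub_ne_zero]
        intro hij
        exact (mem_Ioi.mp hj).ne' (Fin.ext (hw hij))
      rw [hc, hprod]
      congr 1
      apply mul_left_cancel₀ (mul_ne_zero h1 h2)
      linear_combination -key
    · push Not at h
      rw [hprod, prod_range_succ, Matrix.det_eq_zero_of_column_eq_zero (Fin.last (m + 1))]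
      · simp [h.1, h.2]
      · intro i
        simp [linearFormMatrix, prod_range_succ', h.1, h.2]

end HomogeneousDeterminant

section Recurrences

lemma eq_of_recurrence {R : Type*} [CommRing R] {x : R} {G H : ℤ → R}
    (hG : ∀ n, G (n + 2) = x * G (n + 1) + G n) (hH : ∀ n, H (n + 2) = x * H (n + 1) + H n)
    (h0 : G 0 = H 0) (h1 : G 1 = H 1) (n : ℤ) : G n = H n := by
  have : G n = H n ∧ G (n + 1) = H (n + 1) := by
    induction n using Int.induction_on with
    | zero => exact ⟨h0, by simpa using h1⟩
    | succ n ih =>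
      refine ⟨ih.2, ?_⟩
      rw [add_assoc, one_add_one_eq_two, hG, hH, ih.1, ih.2]
    | pred n ih =>
      have e1 := hG (-n - 1)
      have e2 := hH (-n - 1)
      rw [show (-n - 1 + 2 : ℤ) = -n + 1 by ring, sub_add_cancel] at e1 e2
      rw [sub_add_cancel]
      refine ⟨?_, ih.1⟩
      linear_combination ih.2 - x * ih.1 - e1 + e2
  exact this.1

lemma C_neg_one_zpow_add (a b : ℤ) :
    C ((-1 : ℝ) ^ (a + b)) = C ((-1 : ℝ) ^ a) * C ((-1 : ℝ) ^ b) := by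
  rw [zpow_add₀ (by norm_num), C_mul]

lemma eq_C_neg_one_zpow_mul {G : ℤ → ℝ[X]} (hG : ∀ n, G (n + 1) = -G n) (n : ℤ) :
    G n = C ((-1 : ℝ) ^ n) * G 0 := by
  induction n using Int.induction_on with
  | zero => simp
  | succ n ih => rw [hG, ih, C_neg_one_zpow_add]; simp
  | pred n ih =>
    have h := hG (-n - 1)
    have hsign := C_neg_one_zpow_add (-n - 1) 1
    rw [sub_add_cancel] at h hsign
    rw [ih, hsign] at h
    simp only [zpow_one, C_neg, C_1] at h
    linear_combination h

variable {L F : ℤ → ℝ[X]}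

lemma lucas_add (hL : ∀ n, L (n + 2) = X * L (n + 1) + L n) (hF0 : F 0 = 0) (hF1 : F 1 = 1)
    (hF : ∀ n, F (n + 2) = X * F (n + 1) + F n) (a b : ℤ) :
    L (a + b) = L a * F (b + 1) + L (a - 1) * F b := by
  refine eq_of_recurrence (x := X) (G := fun b => L (a + b))
    (H := fun b => L a * F (b + 1) + L (a - 1) * F b) (fun n => ?_) (fun n => ?_) ?_ ?_ b
  · simpa only [add_assoc] using hL (a + n)
  · have h := hF (n + 1)
    rw [show n + 1 + 2 = n + 2 + 1 by ring] at h
    simp only [h, hF n]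
    ring
  · simp [hF0, hF1]
  · have h := hL (a - 1)
    have h' := hF 0
    rw [show a - 1 + 2 = a + 1 by ring, sub_add_cancel] at h
    simp only [zero_add, hF0, hF1] at h'
    simp only [one_add_one_eq_two, h', h, hF1]
    ring

lemma fibonacci_docagne (hF0 : F 0 = 0) (hF1 : F 1 = 1)
    (hF : ∀ n, F (n + 2) = X * F (n + 1) + F n) (a b : ℤ) :
    F (a + 1) * F b - F a * F (b + 1) = C ((-1 : ℝ) ^ a) * F (b - a) := by
  suffices h : ∀ c, F (a + 1) * F (a + c) - F a * F (a + c + 1) = C ((-1 : ℝ) ^ a) * F c by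
    simpa using h (b - a)
  refine eq_of_recurrence (x := X) (fun n => ?_) (fun n => ?_) ?_ ?_
  · have h1 := hF (a + n)
    have h2 := hF (a + n + 1)
    simp only [show a + (n + 2) = a + n + 2 by ring, show a + n + 2 + 1 = a + n + 1 + 2 by ring,
      show a + (n + 1) = a + n + 1 by ring, show a + n + 1 + 1 = a + n + 2 by ring, h1, h2]
    ring
  · rw [hF]; ring
  · simp [hF0, mul_comm]
  · have h := eq_C_neg_one_zpow_mul
      (G := fun a => F (a + 1) * F (a + 1) - F a * F (a + 1 + 1)) (fun n => by
        rw [show n + 1 + 1 + 1 = n + 1 + 2 by ring, hF (n + 1), show n + 1 + 1 = n + 2 by ring, hF n]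
        ring) a
    simpa [hF0, hF1] using h

lemma lucas_docagne (hL0 : L 0 = 2) (hL1 : L 1 = X) (hL : ∀ n, L (n + 2) = X * L (n + 1) + L n)
    (hF0 : F 0 = 0) (hF1 : F 1 = 1) (hF : ∀ n, F (n + 2) = X * F (n + 1) + F n) (a c : ℤ) :
    L (a + c - 1) * L a - L (a - 1) * L (a + c) = C ((-1 : ℝ) ^ a) * (X ^ 2 + C 4) * F c := by
  refine eq_of_recurrence (x := X) (G := fun c => L (a + c - 1) * L a - L (a - 1) * L (a + c))
    (H := fun c => C ((-1 : ℝ) ^ a) * (X ^ 2 + C 4) * F c) (fun n => ?_) (fun n => ?_) ?_ ?_ c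
  · have h1 := hL (a + n)
    have h2 := hL (a + n - 1)
    simp only [show a + (n + 2) = a + n + 2 by ring, show a + (n + 1) = a + n + 1 by ring,
      show a + n + 2 - 1 = a + n - 1 + 2 by ring, add_sub_cancel_right, h1, h2, sub_add_cancel]
    ring
  · simp only [hF]; ring
  · simp [hF0, mul_comm]
  · have h := eq_C_neg_one_zpow_mul
      (G := fun a => L a * L a - L (a - 1) * L (a + 1)) (fun n => by
        have h := hL (n - 1)
        rw [sub_add_cancel, show n - 1 + 2 = n + 1 by ring] at h
        simp only [add_sub_cancel_right, add_assoc, one_add_one_eq_two, hL n, h]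
        ring) a
    have h' := hL (-1)
    norm_num [hL0, hL1] at h'
    simp only [hL0, hL1, zero_add, zero_sub] at h
    simp only [add_sub_cancel_right, h, hF1, mul_one, show (C 4 : ℝ[X]) = 4 from rfl]
    linear_combination C ((-1 : ℝ) ^ a) * X * h'

end Recurrences

lemma prod_prod_Ioi_eq (m : ℕ) (a k : ℤ) (D : ℝ[X]) (F : ℤ → ℝ[X]) :
    ∏ i : Fin (m + 1), ∏ j ∈ Ioi i, (C ((-1 : ℝ) ^ (a + k * i.1)) * D * F (k * (j.1 - i.1)))
      = C ((-1 : ℝ) ^ (a * ((m + 1).choose 2 : ℤ) + k * ((m + 1).choose 3 : ℤ)))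
        * D ^ (m + 1).choose 2 * ∏ l ∈ Icc 1 m, F (k * l) ^ (m + 1 - l) := by
  induction m generalizing a with
  | zero => simp [Nat.choose_eq_zero_of_lt]
  | succ m ih =>
    have hrow : ∏ l ∈ Icc 1 (m + 1), F (k * l) ^ (m + 1 + 1 - l)
        = (∏ l ∈ Icc 1 (m + 1), F (k * l)) * ∏ l ∈ Icc 1 m, F (k * l) ^ (m + 1 - l) := by
      have : ∏ l ∈ Icc 1 m, F (k * l) ^ (m + 1 - l)
          = ∏ l ∈ Icc 1 (m + 1), F (k * l) ^ (m + 1 - l) := by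
        rw [prod_Icc_succ_top (by omega)]; simp
      rw [this, ← prod_mul_distrib]
      refine prod_congr rfl fun l hl => ?_
      rw [← pow_succ', Nat.sub_add_comm (mem_Icc.mp hl).2]
    have hfirst : ∏ j : Fin (m + 1), F (k * ((j.1 + 1 : ℕ) : ℤ))
        = ∏ l ∈ Icc 1 (m + 1), F (k * l) := by
      rw [Fin.prod_univ_eq_prod_range (fun j => F (k * ((j + 1 : ℕ) : ℤ))),
        range_eq_Ico, prod_Ico_add' (fun j : ℕ => F (k * (j : ℤ)))]
      rfl
    have hrest : ∏ i : Fin (m + 1), ∏ j ∈ Ioi i,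
        (C ((-1 : ℝ) ^ (a + k * i.succ.1)) * D * F (k * (j.succ.1 - i.succ.1)))
          = C ((-1 : ℝ) ^ ((a + k) * ((m + 1).choose 2 : ℤ) + k * ((m + 1).choose 3 : ℤ)))
            * D ^ (m + 1).choose 2 * ∏ l ∈ Icc 1 m, F (k * l) ^ (m + 1 - l) := by
      rw [← ih (a + k)]
      refine prod_congr rfl fun i _ => prod_congr rfl fun j _ => ?_
      simp only [Fin.val_succ, Nat.cast_add, Nat.cast_one, add_sub_add_right_eq_sub]
      rw [mul_add, mul_one, add_right_comm, add_assoc a]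
    rw [Fin.prod_univ_succ, Fin.prod_Ioi_zero]
    simp only [Fin.prod_Ioi_succ]
    rw [hrest, hrow]
    simp only [Fin.val_succ, Fin.val_zero, Nat.cast_zero, mul_zero, add_zero,
      sub_zero, prod_mul_distrib, prod_const, card_univ, Fintype.card_fin, hfirst]
    have hsign : C ((-1 : ℝ) ^ a) ^ (m + 1) = C ((-1 : ℝ) ^ (a * ((m + 1 : ℕ) : ℤ))) := by
      rw [← C_pow, zpow_mul, zpow_natCast]
    have hexp : a * ((m + 1 + 1).choose 2 : ℤ) + k * ((m + 1 + 1).choose 3 : ℤ)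
        = a * ((m + 1 : ℕ) : ℤ)
          + ((a + k) * ((m + 1).choose 2 : ℤ) + k * ((m + 1).choose 3 : ℤ)) := by
      rw [Nat.choose_succ_succ' (m + 1) 1, Nat.choose_succ_succ' (m + 1) 2, Nat.choose_one_right]
      push_cast
      ring
    rw [hsign, hexp, C_neg_one_zpow_add (a * _), Nat.choose_succ_succ' (m + 1) 1,
      Nat.choose_one_right, pow_add]
    ring

/-- **Corollary 3, second identity.** For the Lucas polynomials `(L_n(x))_{n∈ℤ}`,
Fibonacci polynomials `(F_n(x))_{n∈ℤ}` and integer sequences `(d_i)`, `(e_i)`,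
`det([∏_{f=j+1}^m L_{s+k(n+i+d_f)}(x) · ∏_{g=1}^j L_{s+k(n+i+e_g)}(x)])
 = (−1)^{(s+kn)C(m+1,2)+kC(m+1,3)} (x²+4)^{C(m+1,2)} ∏_{l=1}^m F_{kl}(x)^{m+1−l}
   · ∏_{1≤i≤j≤m} (−1)^{k d_j} F_{k(e_i−d_j)}(x)`. -/
theorem det_product_matrix_lucas_polynomials
    (m : ℕ) (hm : 1 ≤ m) (s k n : ℤ) (d e : ℕ → ℤ)
    (L F : ℤ → Polynomial ℝ)
    (hL0 : L 0 = 2) (hL1 : L 1 = X)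
    (hLrec : ∀ n : ℤ, L (n + 2) = X * L (n + 1) + L n)
    (hF0 : F 0 = 0) (hF1 : F 1 = 1)
    (hFrec : ∀ n : ℤ, F (n + 2) = X * F (n + 1) + F n) :
    Matrix.det (Matrix.of fun i j : Fin (m + 1) =>
        (∏ f ∈ Finset.Icc (j.1 + 1) m, L (s + k * (n + i.1 + d f)))
          * ∏ g ∈ Finset.Icc 1 j.1, L (s + k * (n + i.1 + e g)))
      = Polynomial.C ((-1 : ℝ)
            ^ ((s + k * n) * (Nat.choose (m + 1) 2 : ℤ)
                + k * (Nat.choose (m + 1) 3 : ℤ)))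
        * (X ^ 2 + Polynomial.C 4) ^ (Nat.choose (m + 1) 2)
        * (∏ l ∈ Finset.Icc 1 m, (F (k * (l : ℤ))) ^ (m + 1 - l))
        * ∏ j ∈ Finset.Icc 1 m, ∏ i ∈ Finset.Icc 1 j,
            (Polynomial.C ((-1 : ℝ) ^ (k * d j)) * F (k * (e i - d j))) := by
  let a : ℕ → ℤ := fun i => s + k * (n + i)
  have hM : (Matrix.of fun i j : Fin (m + 1) =>
        (∏ f ∈ Finset.Icc (j.1 + 1) m, L (s + k * (n + i.1 + d f)))
          * ∏ g ∈ Finset.Icc 1 j.1, L (s + k * (n + i.1 + e g)))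
      = linearFormMatrix m (fun f => F (k * d (f + 1) + 1)) (fun f => F (k * d (f + 1)))
          (fun g => F (k * e (g + 1) + 1)) (fun g => F (k * e (g + 1)))
          (fun i => L (a i)) (fun i => L (a i - 1)) := by
    have hadd (i : ℕ) (c : ℤ) : L (s + k * (n + i + c))
        = L (a i) * F (k * c + 1) + L (a i - 1) * F (k * c) := by
      rw [← lucas_add hLrec hF0 hF1 hFrec]
      congr 1
      ring
    ext1 i j
    simp only [linearFormMatrix, Matrix.of_apply, hadd]
    rw [range_eq_Ico,
      prod_Ico_add' (fun f => L (a i) * F (k * d f + 1) + L (a i - 1) * F (k * d f)),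
      prod_Ico_add' (fun g => L (a i) * F (k * e g + 1) + L (a i - 1) * F (k * e g))]
    rfl
  have hV : (Matrix.projVandermonde (fun i : Fin (m + 1) => L (a i - 1)) fun i => L (a i)).det
      = ∏ i : Fin (m + 1), ∏ j ∈ Ioi i,
        (C ((-1 : ℝ) ^ (s + k * n + k * i.1)) * (X ^ 2 + C 4) * F (k * (j.1 - i.1))) := by
    rw [Matrix.det_projVandermonde]
    refine prod_congr rfl fun i _ => prod_congr rfl fun j _ => ?_
    rw [show s + k * n + k * (i.1 : ℤ) = a i by simp only [a]; ring,
      ← lucas_docagne hL0 hL1 hLrec hF0 hF1 hFrec,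
      show a i + k * ((j.1 : ℤ) - i.1) = a j by simp only [a]; ring]
  rw [hM, det_linearFormMatrix, hV, prod_prod_Ioi_eq]
  congr 1
  have hIcc (N : ℕ) (G : ℕ → ℝ[X]) : ∏ i ∈ Icc 1 N, G i = ∏ i ∈ range N, G (i + 1) := by
    rw [range_eq_Ico, prod_Ico_add']
    rfl
  simp only [hIcc, fibonacci_docagne hF0 hF1 hFrec, mul_sub]
end

section
/- Let m ≥ 1 and let s, k, n be any integers. Let (L_n(x))_{n∈ℤ} be the sequence of Lucas polynomials and (F_n(x))_{n∈ℤ} the sequence of Fibonacci polynomials, and assume L_{s+k(n+i+j)}(x) is a nonzero polynomial for every 0 ≤ i, j ≤ m. Then, in the field of rational functions ℝ(x), det( [ 1 / L_{s+k(n+i+j)}(x) ]_{0≤i,j≤m} ) = ( (−1)^{(s+kn+1)·C(m+1,2)} · (x²+4)^{C(m+1,2)} · ∏_{i=0}^{m} F_{k(i+1)}(x)^{2(m−i)} ) / ( ∏_{0≤i,j≤m} L_{s+k(n+i+j)}(x) ), where C(·,·) are binomial coefficients. -/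
open Polynomial Finset

/-- Cauchy's double alternant in homogeneous form. -/
theorem det_inv_mul_add_mul {K : Type*} [Field K] : ∀ {N : ℕ} (x z y w : Fin N → K),
    (∀ i j, x i * y j + z i * w j ≠ 0) →
    Matrix.det (Matrix.of fun i j => (x i * y j + z i * w j)⁻¹) =
      (∏ i, ∏ j ∈ Ioi i, (x i * z j - x j * z i) * (y j * w i - y i * w j)) /
        ∏ i, ∏ j, (x i * y j + z i * w j) := by
  intro N
  induction N with
  | zero => intros; simp
  | succ N ih =>
    intro x z y w h
    let D : Fin (N + 1) → Fin (N + 1) → K := fun i j => x i * y j + z i * w j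
    have hD : ∀ i j, D i j ≠ 0 := h
    let c : Fin (N + 1) → K := Fin.cons 0 fun i => D 0 0 / D i.succ 0
    let B : Matrix (Fin (N + 1)) (Fin (N + 1)) K :=
      Matrix.of fun i j => (D i j)⁻¹ - c i * (D 0 j)⁻¹
    have elim : Matrix.det (Matrix.of fun i j => (D i j)⁻¹) = B.det := by
      refine Matrix.det_eq_of_forall_row_eq_smul_add_const c 0 rfl fun i j => ?_
      simp [B, c]
    have hB0 : ∀ i : Fin N, B i.succ 0 = 0 := by
      intro i
      have h1 := hD i.succ 0
      have h2 := hD 0 0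
      simp only [B, c, Matrix.of_apply, Fin.cons_succ]
      field_simp
      ring
    have hsub : B.submatrix Fin.succ Fin.succ = Matrix.of fun i j : Fin N =>
        ((x 0 * z i.succ - x i.succ * z 0) / D i.succ 0) *
          (((y j.succ * w 0 - y 0 * w j.succ) / D 0 j.succ) * (D i.succ j.succ)⁻¹) := by
      ext i j
      have h1 := hD i.succ 0
      have h2 := hD 0 j.succ
      have h3 := hD i.succ j.succ
      simp only [B, c, Matrix.submatrix_apply, Matrix.of_apply, Fin.cons_succ]
      field_simp
      simp only [D]
      ring
    have hrow := Matrix.det_mul_column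
      (fun i : Fin N => (x 0 * z i.succ - x i.succ * z 0) / D i.succ 0)
      (Matrix.of fun i j : Fin N =>
        ((y j.succ * w 0 - y 0 * w j.succ) / D 0 j.succ) * (D i.succ j.succ)⁻¹)
    have hcol := Matrix.det_mul_row
      (fun j : Fin N => (y j.succ * w 0 - y 0 * w j.succ) / D 0 j.succ)
      (Matrix.of fun i j : Fin N => (D i.succ j.succ)⁻¹)
    have hdet : B.det = (D 0 0)⁻¹ * (B.submatrix Fin.succ Fin.succ).det := by
      rw [Matrix.det_succ_column_zero, Fin.sum_univ_succ]
      simp [hB0]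
      simp [B, c]
    change Matrix.det (Matrix.of fun i j => (D i j)⁻¹) = _ / ∏ i, ∏ j, D i j
    simp only [Matrix.of_apply] at hrow hcol
    rw [elim, hdet, hsub, hrow, hcol,
      ih (fun i => x i.succ) (fun i => z i.succ) (fun i => y i.succ) (fun i => w i.succ)
        fun i j => h i.succ j.succ]
    simp only [Fin.prod_univ_succ, Fin.prod_Ioi_zero, Fin.prod_Ioi_succ, prod_mul_distrib,
      div_eq_mul_inv, mul_inv, prod_inv_distrib, D]
    ring

theorem Fin.prod_prod_Ioi_sub {M : Type*} [CommMonoid M] (u : M) (f : ℤ → M) (N : ℕ) :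
    ∏ i : Fin N, ∏ j ∈ Ioi i, u * f ((j : ℕ) - (i : ℕ)) =
      u ^ N.choose 2 * ∏ i ∈ range N, f ((i : ℤ) + 1) ^ (N - 1 - i) := by
  induction N with
  | zero => simp
  | succ N ih =>
    rw [Fin.prod_univ_succ, Fin.prod_Ioi_zero]
    simp only [Fin.prod_Ioi_succ, Fin.val_succ, Nat.cast_add, Nat.cast_one,
      add_sub_add_right_eq_sub, ih, Fin.val_zero, Nat.cast_zero, sub_zero]
    rw [prod_mul_distrib, Fin.prod_const, Fin.prod_univ_eq_prod_range (fun i => f ((i : ℤ) + 1)), prod_range_succ,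
      mul_mul_mul_comm, ← pow_add, ← prod_mul_distrib]
    congr 1
    · rw [Nat.choose_succ_succ' N 1, Nat.choose_one_right]
    · simp only [add_tsub_cancel_right, tsub_self, pow_zero, mul_one]
      refine prod_congr rfl fun i hi => ?_
      rw [← pow_succ']
      congr 1
      have := mem_range.1 hi
      omega

section SecondOrderRecurrence

variable {K : Type*} [Field K] {t : K} {G F : ℤ → K}

theorem recurrence_add (hG : ∀ n, G (n + 2) = t * G (n + 1) + G n) (hF0 : F 0 = 0)
    (hF1 : F 1 = 1) (hF : ∀ n, F (n + 2) = t * F (n + 1) + F n) (p q : ℤ) :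
    G (p + q) = G (p + 1) * F q + G p * F (q - 1) := by
  have hFm : F (-1) = 1 := by have := hF (-1); norm_num [hF0, hF1] at this; exact this.symm
  suffices H : G (p + q) = G (p + 1) * F q + G p * F (q - 1) ∧
      G (p + (q + 1)) = G (p + 1) * F (q + 1) + G p * F q from H.1
  induction q using Int.induction_on with
  | zero => simp [hF0, hF1, hFm]
  | succ i ih =>
    obtain ⟨h1, h2⟩ := ih
    have e1 := hG (p + i)
    have e2 := hF i
    have e3 := hF (i - 1)
    ring_nf at h1 h2 e1 e2 e3 ⊢
    refine ⟨h2, ?_⟩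
    linear_combination e1 + t * h2 + h1 - G (1 + p) * e2 - G p * e3
  | pred i ih =>
    obtain ⟨h1, h2⟩ := ih
    have e1 := hG (p + (-i - 1))
    have e2 := hF (-i - 1)
    have e3 := hF (-i - 2)
    ring_nf at h1 h2 e1 e2 e3 ⊢
    refine ⟨?_, h1⟩
    linear_combination h2 - t * h1 - e1 + G (1 + p) * e2 + G p * e3

theorem recurrence_cassini (hG : ∀ n, G (n + 2) = t * G (n + 1) + G n) (p : ℤ) :
    G (p + 1) ^ 2 - G p ^ 2 - t * G p * G (p + 1) =
      (-1) ^ p * (G 1 ^ 2 - G 0 ^ 2 - t * G 0 * G 1) := by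
  have step (p : ℤ) : G (p + 1 + 1) ^ 2 - G (p + 1) ^ 2 - t * G (p + 1) * G (p + 1 + 1) =
      -(G (p + 1) ^ 2 - G p ^ 2 - t * G p * G (p + 1)) := by
    rw [add_assoc, one_add_one_eq_two, hG]
    ring
  induction p using Int.induction_on with
  | zero => simp
  | succ i ih =>
    rw [step, ih, zpow_add_one₀ (by simp)]
    ring
  | pred i ih =>
    have := step (-i - 1)
    rw [sub_add_cancel, ih] at this
    rw [sub_add_cancel, zpow_sub_one₀ (by simp), inv_neg_one]
    linear_combination this

theorem recurrence_dOcagne (hG : ∀ n, G (n + 2) = t * G (n + 1) + G n) (hF0 : F 0 = 0)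
    (hF1 : F 1 = 1) (hF : ∀ n, F (n + 2) = t * F (n + 1) + F n) (p d : ℤ) :
    G (p + 1) * G (p + d) - G (p + d + 1) * G p =
      (-1) ^ p * (G 1 ^ 2 - G 0 ^ 2 - t * G 0 * G 1) * F d := by
  have h1 := recurrence_add hG hF0 hF1 hF p d
  have h2 := recurrence_add hG hF0 hF1 hF p (d + 1)
  have e := hF (d - 1)
  rw [← recurrence_cassini hG p]
  ring_nf at h1 h2 e ⊢
  linear_combination G (1 + p) * h1 - G p * h2 - G p * G (1 + p) * e

end SecondOrderRecurrence

/-- **Corollary 3, third identity.** For the Lucas polynomials `(L_n(x))_{n∈ℤ}` and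
Fibonacci polynomials `(F_n(x))_{n∈ℤ}`, if every `L_{s+k(n+i+j)}(x)` is a nonzero
polynomial, then in `ℝ(x)`:
`det([1/L_{s+k(n+i+j)}(x)]) = (−1)^{(s+kn+1)C(m+1,2)} (x²+4)^{C(m+1,2)}
  ∏_{i=0}^m F_{k(i+1)}(x)^{2(m−i)} / ∏_{0≤i,j≤m} L_{s+k(n+i+j)}(x)`. -/
theorem det_reciprocal_matrix_lucas_polynomials
    (m : ℕ) (hm : 1 ≤ m) (s k n : ℤ)
    (L F : ℤ → Polynomial ℝ)
    (hL0 : L 0 = 2) (hL1 : L 1 = X)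
    (hLrec : ∀ n : ℤ, L (n + 2) = X * L (n + 1) + L n)
    (hF0 : F 0 = 0) (hF1 : F 1 = 1)
    (hFrec : ∀ n : ℤ, F (n + 2) = X * F (n + 1) + F n)
    (hne : ∀ i j : Fin (m + 1), L (s + k * (n + i.1 + j.1)) ≠ 0) :
    Matrix.det (Matrix.of fun i j : Fin (m + 1) =>
        (algebraMap (Polynomial ℝ) (RatFunc ℝ) (L (s + k * (n + i.1 + j.1))))⁻¹)
      = ((-1 : RatFunc ℝ) ^ ((s + k * n + 1) * (Nat.choose (m + 1) 2 : ℤ))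
          * (algebraMap (Polynomial ℝ) (RatFunc ℝ) (X ^ 2 + Polynomial.C 4))
              ^ (Nat.choose (m + 1) 2)
          * ∏ i ∈ Finset.range (m + 1),
              (algebraMap (Polynomial ℝ) (RatFunc ℝ) (F (k * ((i : ℤ) + 1))))
                ^ (2 * (m - i)))
        / ∏ i ∈ Finset.range (m + 1), ∏ j ∈ Finset.range (m + 1),
            algebraMap (Polynomial ℝ) (RatFunc ℝ) (L (s + k * (n + i + j))) := by
  let φ := algebraMap (Polynomial ℝ) (RatFunc ℝ)
  let l : ℤ → RatFunc ℝ := fun i => φ (L i)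
  let f : ℤ → RatFunc ℝ := fun i => φ (F i)
  have hl (i : ℤ) : l (i + 2) = φ X * l (i + 1) + l i := by simp [l, hLrec]
  have hf (i : ℤ) : f (i + 2) = φ X * f (i + 1) + f i := by simp [f, hFrec]
  have hf0 : f 0 = 0 := by simp [f, hF0]
  have hf1 : f 1 = 1 := by simp [f, hF1]
  have hl0 : l 0 = 2 := by simpa [l, hL0] using map_ofNat φ 2
  have hl1 : l 1 = φ X := by simp [l, hL1]
  have hdisc : φ (X ^ 2 + Polynomial.C 4) = φ X ^ 2 + 4 := by
    simp only [map_add, map_pow]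
    congr 1
    rw [show (Polynomial.C (4 : ℝ)) = 4 from rfl, map_ofNat]
  let a := s + k * n
  have hentry (i j : ℕ) : l (a + k * i + 1) * f (k * j) + l (a + k * i) * f (k * j - 1) =
      φ (L (s + k * (n + i + j))) := by
    rw [← recurrence_add hl hf0 hf1 hf]
    simp only [l, a]
    congr 2
    ring
  have hpair (i j : ℕ) :
      (l (a + k * i + 1) * l (a + k * j) - l (a + k * j + 1) * l (a + k * i)) *
        (f (k * j) * f (k * i - 1) - f (k * i) * f (k * j - 1)) =
      ((-1) ^ (a + 1) * φ (X ^ 2 + Polynomial.C 4)) * f (k * ((j : ℤ) - i)) ^ 2 := by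
    have h1 := recurrence_dOcagne hl hf0 hf1 hf (a + k * i) (k * ((j : ℤ) - i))
    have h2 := recurrence_dOcagne hf hf0 hf1 hf (k * i - 1) (k * ((j : ℤ) - i))
    rw [show a + k * i + k * ((j : ℤ) - i) = a + k * j by ring, hl0, hl1] at h1
    rw [show k * i - 1 + k * ((j : ℤ) - i) = k * j - 1 by ring, hf0, hf1, sub_add_cancel,
      sub_add_cancel] at h2
    have hsq : ((-1 : RatFunc ℝ) ^ (k * i)) * (-1) ^ (k * i) = 1 := by
      rw [← mul_zpow]; simp
    rw [zpow_add₀ (by simp)] at h1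
    rw [zpow_sub_one₀ (by simp), inv_neg_one] at h2
    rw [h1, hdisc, zpow_add_one₀ (by simp),
      show f (k * j) * f (k * i - 1) - f (k * i) * f (k * j - 1) =
        -(f (k * i) * f (k * j - 1) - f (k * j) * f (k * i - 1)) by ring, h2]
    linear_combination (-(-1 : RatFunc ℝ) ^ a * (φ X ^ 2 + 4) * f (k * ((j : ℤ) - i)) ^ 2) * hsq
  have hcauchy := det_inv_mul_add_mul (N := m + 1)
    (fun i => l (a + k * (i : ℕ) + 1)) (fun i => l (a + k * (i : ℕ)))
    (fun j => f (k * (j : ℕ))) (fun j => f (k * (j : ℕ) - 1)) fun i j => by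
      rw [hentry]
      exact RatFunc.algebraMap_ne_zero (hne i j)
  simp only [hentry, hpair] at hcauchy
  refine hcauchy.trans ?_
  rw [Fin.prod_prod_Ioi_sub _ (fun d => f (k * d) ^ 2), mul_pow, ← zpow_natCast (_ ^ (a + 1)),
    ← zpow_mul]
  simp only [← pow_mul, add_tsub_cancel_right]
  congr 1
  rw [← Fin.prod_univ_eq_prod_range
    (fun i => ∏ j ∈ range (m + 1), φ (L (s + k * (n + i + j))))]
  refine prod_congr rfl fun i _ => ?_
  rw [← Fin.prod_univ_eq_prod_range (fun j => φ (L (s + k * (n + (i : ℕ) + j))))]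
end

section
/- Let n ≥ 1 and m ≥ 1, and let (F_n)_{n≥0} be the Fibonacci numbers. Then the determinant of the (m+1)×(m+1) real matrix with (i,j) entry 1/F_{n+i+j} (indices 0 ≤ i, j ≤ m) equals ( (−1)^{n·C(m+1,2)} · ∏_{i=0}^{m} F_{i+1}^{2(m−i)} ) / ( ∏_{0≤i,j≤m} F_{n+i+j} ), where C(m+1,2) is the binomial coefficient. -/
open Finset

/-- Vajda's identity for the Fibonacci numbers, over an arbitrary commutative ring. -/
theorem fib_add_mul_fib_add_sub {R : Type*} [CommRing R] (N a b : ℕ) :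
    (Nat.fib (N + a) : R) * Nat.fib (N + b) - Nat.fib (N + a + b) * Nat.fib N
      = (-1) ^ N * (Nat.fib a * Nat.fib b) := by
  induction a using Nat.twoStepInduction with
  | zero => simp [mul_comm]
  | one =>
    induction N generalizing b with
    | zero => simp
    | succ N ih =>
      have h := ih b
      have h1 : Nat.fib (N + 1 + 1 + b) = Nat.fib (N + b) + Nat.fib (N + 1 + b) := by
        rw [show N + 1 + 1 + b = N + b + 2 by ring, Nat.fib_add_two]
        congr 2; ring
      rw [h1, Nat.fib_add_two, pow_succ]
      push_cast
      linear_combination -h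
  | more a ih₀ ih₁ =>
    have h1 : Nat.fib (N + (a + 2)) = Nat.fib (N + a) + Nat.fib (N + (a + 1)) := Nat.fib_add_two
    have h2 : Nat.fib (N + (a + 2) + b) = Nat.fib (N + a + b) + Nat.fib (N + (a + 1) + b) := by
      rw [show N + (a + 2) + b = N + a + b + 2 by ring, Nat.fib_add_two]
      congr 2; ring
    rw [h1, h2, Nat.fib_add_two]
    push_cast
    linear_combination ih₀ + ih₁

/-- Schur complement formula for the determinant with respect to the last diagonal entry. -/
theorem Matrix.det_succ_eq_mul_det_schur {K : Type*} [Field K] {k : ℕ}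
    (A : Matrix (Fin (k + 1)) (Fin (k + 1)) K) (h : A (Fin.last k) (Fin.last k) ≠ 0) :
    A.det = A (Fin.last k) (Fin.last k) *
      (Matrix.of fun i j : Fin k => A i.castSucc j.castSucc
        - A i.castSucc (Fin.last k) * A (Fin.last k) j.castSucc
          / A (Fin.last k) (Fin.last k)).det := by
  have hl : Fin.natAdd k (0 : Fin 1) = Fin.last k := rfl
  let e : Fin k ⊕ Fin 1 ≃ Fin (k + 1) := finSumFinEquiv
  have hD : IsUnit (A.submatrix e e).toBlocks₂₂ := by
    rw [Matrix.isUnit_iff_isUnit_det, isUnit_iff_ne_zero]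
    simpa [Matrix.toBlocks₂₂, e, hl] using h
  let := hD.invertible
  rw [← Matrix.det_submatrix_equiv_self e A, ← Matrix.fromBlocks_toBlocks (A.submatrix e e),
    Matrix.det_fromBlocks₂₂]
  congr 1
  · simp [Matrix.toBlocks₂₂, e, hl]
  · congr 1
    ext i j
    rw [Matrix.invOf_eq_nonsing_inv, Matrix.inv_def, Matrix.adjugate_fin_one]
    simp [Matrix.mul_apply, Matrix.toBlocks₁₁, Matrix.toBlocks₁₂, Matrix.toBlocks₂₁,
      Matrix.toBlocks₂₂, e, hl, Fin.castAdd, Fin.castSucc]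
    ring

/-- Recursion in the size for the Hankel determinants of reciprocal Fibonacci numbers. -/
theorem det_reciprocal_fib_succ (n k : ℕ) (hn : 1 ≤ n) :
    Matrix.det (Matrix.of fun i j : Fin (k + 1) => (1 : ℝ) / (Nat.fib (n + i.1 + j.1) : ℝ))
      = Matrix.det (Matrix.of fun i j : Fin k => (1 : ℝ) / (Nat.fib (n + i.1 + j.1) : ℝ))
        * ((-1) ^ (n * k) * ∏ i ∈ range k, (Nat.fib (i + 1) : ℝ) ^ 2)
        / ((∏ i ∈ range k, (Nat.fib (n + i + k) : ℝ)) ^ 2 * Nat.fib (n + k + k)) := by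
  have hF : ∀ p : ℕ, (Nat.fib (n + p) : ℝ) ≠ 0 := fun p =>
    Nat.cast_ne_zero.mpr (Nat.fib_pos.mpr (by lia)).ne'
  rw [Matrix.det_succ_eq_mul_det_schur _ (by simpa [add_assoc] using hF (k + k))]
  let v : Fin k → ℝ := fun i => (-1) ^ i.1 * Nat.fib (k - i) / Nat.fib (n + i + k)
  let B : Matrix (Fin k) (Fin k) ℝ := Matrix.of fun i j => 1 / (Nat.fib (n + i.1 + j.1) : ℝ)
  have hS : (Matrix.of fun i j : Fin k =>
      (1 : ℝ) / (Nat.fib (n + i.1 + j.1) : ℝ)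
        - 1 / (Nat.fib (n + i.1 + k) : ℝ) * (1 / (Nat.fib (n + k + j.1) : ℝ))
          / (1 / (Nat.fib (n + k + k) : ℝ)))
      = (-1 : ℝ) ^ n • (Matrix.diagonal v * B * Matrix.diagonal v) := by
    ext i j
    have hv := fib_add_mul_fib_add_sub (R := ℝ) (n + i + j) (k - j) (k - i)
    have e1 : n + i.1 + j + (k - j) = n + (i + k) := by lia
    have e2 : n + i.1 + j + (k - i) = n + (j + k) := by lia
    have e3 : n + (i.1 + k) + (k - i) = n + (k + k) := by lia
    rw [e1, e2, e3] at hv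
    have hij := hF (i + j)
    have hik := hF (i + k)
    have hjk := hF (j + k)
    have hkk := hF (k + k)
    rw [Matrix.smul_apply, Matrix.mul_diagonal, Matrix.diagonal_mul]
    simp only [Matrix.of_apply, B, v, smul_eq_mul, add_assoc, pow_add, add_comm k j.1] at *
    field_simp
    linear_combination hv
  have hv : ∏ i, v i ^ 2
      = (∏ i ∈ range k, (Nat.fib (i + 1) : ℝ) ^ 2)
        / (∏ i ∈ range k, (Nat.fib (n + i + k) : ℝ)) ^ 2 := by
    rw [Fin.prod_univ_eq_prod_range
      (fun i => ((-1) ^ i * (Nat.fib (k - i) : ℝ) / Nat.fib (n + i + k)) ^ 2) k,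
      ← Finset.prod_range_reflect (fun i => (Nat.fib (i + 1) : ℝ) ^ 2), ← Finset.prod_pow,
      ← Finset.prod_div_distrib]
    refine Finset.prod_congr rfl fun i hi => ?_
    rw [Finset.mem_range] at hi
    rw [show k - 1 - i + 1 = k - i by lia, div_pow, mul_pow, ← pow_mul, mul_comm i 2,
      pow_mul]
    simp
  simp only [Matrix.of_apply, Fin.val_castSucc, Fin.val_last]
  rw [hS, Matrix.det_smul, Matrix.det_mul, Matrix.det_mul, Matrix.det_diagonal, Fintype.card_fin,
    pow_mul]
  rw [Finset.prod_pow] at hv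
  rw [show (∏ i, v i) * B.det * ∏ i, v i = B.det * (∏ i, v i) ^ 2 by ring, hv]
  simp only [B, div_eq_mul_inv, mul_inv]
  ring

/-- **Identity (5).** For the Fibonacci numbers and `n ≥ 1`, `m ≥ 1`,
`det([1/F_{n+i+j}]_{0≤i,j≤m})
  = (−1)^{n·C(m+1,2)} · ∏_{i=0}^m F_{i+1}^{2(m−i)} / ∏_{0≤i,j≤m} F_{n+i+j}`. -/
theorem det_reciprocal_fibonacci_numbers (n m : ℕ) (hn : 1 ≤ n) (hm : 1 ≤ m) :
    Matrix.det (Matrix.of fun i j : Fin (m + 1) =>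
        (1 : ℝ) / (Nat.fib (n + i.1 + j.1) : ℝ))
      = ((-1 : ℝ) ^ (n * Nat.choose (m + 1) 2)
          * ∏ i ∈ Finset.range (m + 1), (Nat.fib (i + 1) : ℝ) ^ (2 * (m - i)))
        / ∏ i ∈ Finset.range (m + 1), ∏ j ∈ Finset.range (m + 1),
            (Nat.fib (n + i + j) : ℝ) := by
  clear hm
  induction m with
  | zero => simp
  | succ m ih =>
    have hN : ∏ i ∈ range (m + 1 + 1), (Nat.fib (i + 1) : ℝ) ^ (2 * (m + 1 - i))
        = (∏ i ∈ range (m + 1), (Nat.fib (i + 1) : ℝ) ^ (2 * (m - i)))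
          * ∏ i ∈ range (m + 1), (Nat.fib (i + 1) : ℝ) ^ 2 := by
      rw [prod_range_succ, Nat.sub_self, mul_zero, pow_zero, mul_one, ← prod_mul_distrib]
      refine prod_congr rfl fun i hi => ?_
      rw [mem_range] at hi
      rw [← pow_add]
      congr 1
      lia
    have hD : ∏ i ∈ range (m + 1 + 1), ∏ j ∈ range (m + 1 + 1), (Nat.fib (n + i + j) : ℝ)
        = (∏ i ∈ range (m + 1), ∏ j ∈ range (m + 1), (Nat.fib (n + i + j) : ℝ))
          * ((∏ i ∈ range (m + 1), (Nat.fib (n + i + (m + 1)) : ℝ)) ^ 2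
            * Nat.fib (n + (m + 1) + (m + 1))) := by
      simp only [prod_range_succ _ (m + 1), prod_mul_distrib]
      simp only [add_right_comm n (m + 1)]
      ring
    rw [det_reciprocal_fib_succ n (m + 1) hn, ih, hN, hD, Nat.choose_succ_succ' (m + 1) 1,
      Nat.choose_one_right, mul_add, pow_add]
    rw [div_mul_eq_mul_div, div_div]
    congr 1
    ring
end
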